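/- Let S be a set of probability measures on ℝ, each with finite mean and full support (positive measure on every nonempty open interval of ℝ), and suppose there is a constant c such that T_μ(m(μ)) = c for every μ ∈ S. Then the dominant-distribution relation ⪯ defined by μ₁ ⪯ μ₂ iff T_{μ₁}(m(μ₂)) ≤ T_{μ₂}(m(μ₁)) satisfies: (i) reflexivity: μ ⪯ μ for all μ ∈ S; (ii) transitivity: if μ₁ ⪯ μ₂ and μ₂ ⪯ μ₃ for μ₁, μ₂, μ₃ ∈ S then μ₁ ⪯ μ₃; (iii) antisymmetry up to equivalence: if μ₁ ⪯ μ₂ and μ₂ ⪯ μ₁ for μ₁, μ₂ ∈ S, then m(μ₁) = m(μ₂) and T_{μ₁}(m(μ₂)) = T_{μ₂}(m(μ₁)). Hence ⪯ is a partial order on S modulo this equivalence. -/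

import Mathlib

open MeasureTheory

/-- The mean of a measure on ℝ. -/
noncomputable def distMean (μ : Measure ℝ) : ℝ := ∫ x, x ∂μ

/-- The upper-tail probability of a measure on ℝ at threshold `t`. -/
noncomputable def tailProb (μ : Measure ℝ) (t : ℝ) : ENNReal := μ {x | t ≤ x}

/-- A measure on ℝ has full support: positive measure on every nonempty open interval. -/
def FullSupport (μ : Measure ℝ) : Prop := ∀ a b : ℝ, a < b → 0 < μ (Set.Ioo a b)

/-- The dominant-distribution relation: `μ₂` dominates `μ₁`. -/
noncomputable def Dominates (μ₁ μ₂ : Measure ℝ) : Prop :=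
  tailProb μ₁ (distMean μ₂) ≤ tailProb μ₂ (distMean μ₁)

theorem tailProb_anti (μ : Measure ℝ) {a b : ℝ} (h : a ≤ b) :
    tailProb μ b ≤ tailProb μ a :=
  measure_mono fun _ hx => le_trans h hx

theorem tailProb_strict (μ : Measure ℝ) [IsProbabilityMeasure μ] (hs : FullSupport μ)
    {a b : ℝ} (h : a < b) : tailProb μ b < tailProb μ a := by
  have hd : Disjoint {x : ℝ | b ≤ x} (Set.Ioo a b) := by
    rw [Set.disjoint_left]
    intro x hx hy
    exact absurd hy.2 (not_lt.mpr hx)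
  have h1 : μ {x : ℝ | b ≤ x} + μ (Set.Ioo a b) ≤ μ {x : ℝ | a ≤ x} := by
    rw [← measure_union hd measurableSet_Ioo]
    apply measure_mono
    rintro x (hx | hx)
    · exact h.le.trans hx
    · exact hx.1.le
  exact lt_of_lt_of_le
    (ENNReal.lt_add_right (measure_ne_top μ _) (hs a b h).ne') h1

theorem dominates_iff (c : ENNReal) (μ ν : Measure ℝ) [IsProbabilityMeasure μ]
    [IsProbabilityMeasure ν] (hμ : FullSupport μ) (hν : FullSupport ν)
    (h1 : tailProb μ (distMean μ) = c) (h2 : tailProb ν (distMean ν) = c) :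
    Dominates μ ν ↔ distMean μ ≤ distMean ν := by
  constructor
  · intro h
    by_contra hlt
    rw [not_le] at hlt
    have a1 := tailProb_strict μ hμ hlt
    have a2 := tailProb_strict ν hν hlt
    rw [h1] at a1
    rw [h2] at a2
    exact absurd h (not_le.mpr (a2.trans a1))
  · intro h
    have a1 := tailProb_anti μ h
    have a2 := tailProb_anti ν h
    rw [h1] at a1
    rw [h2] at a2
    exact a1.trans a2

/-- Theorem 1: the dominant-distribution relation is a partial order
(reflexive, transitive, and antisymmetric up to equivalence) on any set of
probability measures with finite means, full support, and equal central tail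
probabilities. -/
theorem dominant_partialOrder
    (S : Set (Measure ℝ)) (c : ENNReal)
    (hprob : ∀ μ ∈ S, IsProbabilityMeasure μ)
    (hint : ∀ μ ∈ S, Integrable id μ)
    (hsupp : ∀ μ ∈ S, FullSupport μ)
    (hbal : ∀ μ ∈ S, tailProb μ (distMean μ) = c) :
    (∀ μ ∈ S, Dominates μ μ) ∧
    (∀ μ₁ ∈ S, ∀ μ₂ ∈ S, ∀ μ₃ ∈ S,
      Dominates μ₁ μ₂ → Dominates μ₂ μ₃ → Dominates μ₁ μ₃) ∧
    (∀ μ₁ ∈ S, ∀ μ₂ ∈ S, Dominates μ₁ μ₂ → Dominates μ₂ μ₁ →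
      distMean μ₁ = distMean μ₂ ∧
        tailProb μ₁ (distMean μ₂) = tailProb μ₂ (distMean μ₁)) := by
  have key : ∀ μ ∈ S, ∀ ν ∈ S, (Dominates μ ν ↔ distMean μ ≤ distMean ν) := by
    intro μ hμ ν hν
    haveI := hprob μ hμ
    haveI := hprob ν hν
    exact dominates_iff c μ ν (hsupp μ hμ) (hsupp ν hν) (hbal μ hμ) (hbal ν hν)
  refine ⟨fun μ hμ => (key μ hμ μ hμ).2 le_rfl, ?_, ?_⟩
  · intro μ₁ h1 μ₂ h2 μ₃ h3 h12 h23
    exact (key _ h1 _ h3).2 (((key _ h1 _ h2).1 h12).trans ((key _ h2 _ h3).1 h23))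
  · intro μ₁ h1 μ₂ h2 h12 h21
    exact ⟨le_antisymm ((key _ h1 _ h2).1 h12) ((key _ h2 _ h1).1 h21), le_antisymm h12 h21⟩
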